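/- arXiv:math/0411081 — 2 statements merged into one kernel-verified Lean document; each statement's English description precedes it below -/
import Mathlib

section
/- Fix integers r ≥ 1 and m₁, …, m_r ≥ 1, and y ∈ ℂ with y ≠ 0 and y ≠ 1. For each integer N ≥ r+1 and all sufficiently small ε > 0, the value χ_N(y) = (1/(1−y)) · (1/(2πi)) ∮_{|z|=ε} ∏_{i=1}^{r} (1−e^{−m_i z})/(1−y e^{−m_i z}) · ((1−y e^{−z})/(1−e^{−z}))^N dz is independent of ε, and there exists δ > 0 such that for every t ∈ ℂ with |t| < δ, the series ∑_{N=r+1}^∞ χ_N(y) · t^{N−1} converges with sum equal to (1/((1−t)(1−yt))) · ∏_{j=1}^{r} ((1−yt)^{m_j} − (1−t)^{m_j}) / ((1−yt)^{m_j} − y(1−t)^{m_j}). -/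
open Complex
open Filter Topology

/-- A property that holds near `0` holds on all sufficiently small closed balls. -/
theorem eventually_forall_mem_closedBall_of_eventually_nhds {P : ℂ → Prop}
    (h : ∀ᶠ z in 𝓝 (0 : ℂ), P z) :
    ∀ᶠ ε in 𝓝[>] (0 : ℝ), 0 < ε ∧ ∀ z ∈ Metric.closedBall (0 : ℂ) ε, P z := by
  obtain ⟨δ, hδ, hP⟩ := Metric.eventually_nhds_iff_ball.1 h
  filter_upwards [Ioo_mem_nhdsGT hδ] with ε hε
  exact ⟨hε.1, fun z hz => hP z (Metric.closedBall_subset_ball hε.2 hz)⟩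

/-- An analytic function has vanishing integral over small circles. -/
theorem AnalyticAt.eventually_circleIntegral_eq_zero {f : ℂ → ℂ} (hf : AnalyticAt ℂ f 0) :
    ∀ᶠ ε in 𝓝[>] (0 : ℝ), (∮ z in C(0, ε), f z) = 0 := by
  filter_upwards [eventually_forall_mem_closedBall_of_eventually_nhds
    hf.eventually_analyticAt] with ε hε
  refine Complex.circleIntegral_eq_zero_of_differentiable_on_off_countable hε.1.le
    Set.countable_empty (fun z hz => (hε.2 z hz).continuousAt.continuousWithinAt)
    fun z hz => (hε.2 z (Metric.ball_subset_closedBall hz.1)).differentiableAt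

theorem AnalyticAt.dslope_zero {f : ℂ → ℂ} (hf : AnalyticAt ℂ f 0) :
    AnalyticAt ℂ (dslope f 0) 0 := by
  obtain ⟨p, hp⟩ := hf
  exact ⟨_, hp.has_fpower_series_dslope_fslope⟩

theorem eq_add_mul_dslope_zero (f : ℂ → ℂ) (z : ℂ) : f z = f 0 + z * dslope f 0 z := by
  have h := sub_smul_dslope f 0 z
  rw [sub_zero, smul_eq_mul] at h
  rw [h]
  ring

/-- Near a simple zero at `0`, the function is analytic and vanishes only at `0`. -/
theorem AnalyticAt.eventually_analyticAt_and_ne_zero {g : ℂ → ℂ} (hg : AnalyticAt ℂ g 0)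
    (hg0 : g 0 = 0) (hg' : deriv g 0 ≠ 0) :
    ∀ᶠ z in 𝓝 (0 : ℂ), AnalyticAt ℂ g z ∧ (z ≠ 0 → g z ≠ 0) := by
  have hu : dslope g 0 0 ≠ 0 := by rwa [dslope_same]
  filter_upwards [hg.eventually_analyticAt,
    hg.dslope_zero.continuousAt.eventually_ne hu] with z hz hz'
  refine ⟨hz, fun h => ?_⟩
  rw [eq_add_mul_dslope_zero g z, hg0, zero_add]
  exact mul_ne_zero h hz'

/-- The logarithmic derivative at a simple zero has residue `1`. -/
theorem AnalyticAt.eventually_circleIntegral_deriv_div {g : ℂ → ℂ} (hg : AnalyticAt ℂ g 0)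
    (hg0 : g 0 = 0) (hg' : deriv g 0 ≠ 0) :
    ∀ᶠ ε in 𝓝[>] (0 : ℝ), (∮ z in C(0, ε), deriv g z / g z) = 2 * Real.pi * I := by
  set u := dslope g 0 with hu_def
  have hu : AnalyticAt ℂ u 0 := hg.dslope_zero
  have hu0 : u 0 ≠ 0 := by rwa [hu_def, dslope_same]
  have hgu : g = fun z => z * u z := by
    funext z
    rw [eq_add_mul_dslope_zero g z, hg0, zero_add]
  have hL : AnalyticAt ℂ (fun z => deriv u z / u z) 0 := hu.deriv.div hu hu0
  filter_upwards [hL.eventually_circleIntegral_eq_zero,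
    eventually_forall_mem_closedBall_of_eventually_nhds (hL.eventually_analyticAt.and
      (hu.eventually_analyticAt.and (hu.continuousAt.eventually_ne hu0)))] with ε hε hball
  obtain ⟨hpos, hball⟩ := hball
  have hsub : Metric.sphere (0 : ℂ) ε ⊆ Metric.closedBall 0 ε := Metric.sphere_subset_closedBall
  have hne : ∀ z ∈ Metric.sphere (0 : ℂ) ε, z ≠ 0 := fun z hz =>
    ne_zero_of_mem_sphere hpos.ne' ⟨z, hz⟩
  have hcongr : (∮ z in C(0, ε), deriv g z / g z) =
      ∮ z in C(0, ε), ((z - 0)⁻¹ + deriv u z / u z) := by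
    refine circleIntegral.integral_congr hpos.le fun z hz => ?_
    obtain ⟨-, hua, hune⟩ := hball z (hsub hz)
    have hd : deriv g z = u z + z * deriv u z := by
      rw [hgu]
      simpa using ((hasDerivAt_id' z).fun_mul hua.differentiableAt.hasDerivAt).deriv
    have hz0 := hne z hz
    simp only [hd, sub_zero]
    rw [congrFun hgu z]
    field_simp
  rw [hcongr, circleIntegral.integral_add, hε, circleIntegral.integral_sub_center_inv 0 hpos.ne',
    add_zero]
  · refine ContinuousOn.circleIntegrable hpos.le fun z hz => ?_
    exact ((continuousAt_id.sub continuousAt_const).inv₀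
      (by simpa using hne z hz)).continuousWithinAt
  · exact ContinuousOn.circleIntegrable hpos.le fun z hz =>
      (hball z (hsub hz)).1.continuousAt.continuousWithinAt

/-- The residue of `g' / g ^ (n + 2)` at a simple zero of `g` vanishes. -/
theorem AnalyticAt.eventually_circleIntegral_deriv_div_pow {g : ℂ → ℂ} (hg : AnalyticAt ℂ g 0)
    (hg0 : g 0 = 0) (hg' : deriv g 0 ≠ 0) (n : ℕ) :
    ∀ᶠ ε in 𝓝[>] (0 : ℝ), (∮ z in C(0, ε), deriv g z / g z ^ (n + 2)) = 0 := by
  filter_upwards [eventually_forall_mem_closedBall_of_eventually_nhds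
    (hg.eventually_analyticAt_and_ne_zero hg0 hg')] with ε hε
  obtain ⟨hpos, hball⟩ := hε
  refine circleIntegral.integral_eq_zero_of_hasDerivWithinAt hpos.le
    (f := fun z => -((n : ℂ) + 1)⁻¹ * (g z ^ (n + 1))⁻¹) fun z hz => ?_
  obtain ⟨hga, hgne⟩ := hball z (Metric.sphere_subset_closedBall hz)
  have hgz : g z ≠ 0 := hgne (ne_zero_of_mem_sphere hpos.ne' ⟨z, hz⟩)
  have hn : (n : ℂ) + 1 ≠ 0 := Nat.cast_add_one_ne_zero n
  have h := (((hga.differentiableAt.hasDerivAt.pow (n + 1)).inv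
    (pow_ne_zero _ hgz)).const_mul (-((n : ℂ) + 1)⁻¹)).hasDerivWithinAt
      (s := Metric.sphere (0 : ℂ) ε)
  refine h.congr_deriv ?_
  simp only [Pi.pow_apply, Nat.add_sub_cancel, Nat.cast_add, Nat.cast_one]
  field_simp
  ring

/-- The pullback of an analytic differential under `g` is analytic. -/
theorem AnalyticAt.comp_mul_deriv {g K : ℂ → ℂ} (hg : AnalyticAt ℂ g 0) (hg0 : g 0 = 0)
    (hK : AnalyticAt ℂ K 0) : AnalyticAt ℂ (fun z => K (g z) * deriv g z) 0 := by
  refine AnalyticAt.mul (AnalyticAt.fun_comp ?_ hg) hg.deriv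
  rwa [hg0]

/-- Splitting off the constant term of `K` in the integral of `K(g) g' / g ^ (k + 1)`. -/
theorem AnalyticAt.eventually_circleIntegral_comp_mul_deriv_div_pow_succ {g K : ℂ → ℂ}
    (hg : AnalyticAt ℂ g 0) (hg0 : g 0 = 0) (hg' : deriv g 0 ≠ 0) (hK : AnalyticAt ℂ K 0)
    (k : ℕ) :
    ∀ᶠ ε in 𝓝[>] (0 : ℝ), (∮ z in C(0, ε), K (g z) * deriv g z / g z ^ (k + 1)) =
      K 0 * (∮ z in C(0, ε), deriv g z / g z ^ (k + 1)) +
        ∮ z in C(0, ε), dslope K 0 (g z) * deriv g z / g z ^ k := by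
  have hDg := hg.comp_mul_deriv hg0 hK.dslope_zero
  filter_upwards [eventually_forall_mem_closedBall_of_eventually_nhds
    (hDg.eventually_analyticAt.and (hg.eventually_analyticAt_and_ne_zero hg0 hg'))] with ε hε
  obtain ⟨hpos, hball⟩ := hε
  have hgne : ∀ z ∈ Metric.sphere (0 : ℂ) ε, g z ≠ 0 := fun z hz =>
    (hball z (Metric.sphere_subset_closedBall hz)).2.2 (ne_zero_of_mem_sphere hpos.ne' ⟨z, hz⟩)
  rw [← circleIntegral.integral_const_mul, ← circleIntegral.integral_add]
  · refine circleIntegral.integral_congr hpos.le fun z hz => ?_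
    have hgz := hgne z hz
    rw [eq_add_mul_dslope_zero K (g z)]
    field_simp
    ring
  · refine ContinuousOn.circleIntegrable hpos.le fun z hz => ContinuousAt.continuousWithinAt ?_
    have hga := (hball z (Metric.sphere_subset_closedBall hz)).2.1
    exact continuousAt_const.mul (hga.deriv.continuousAt.div (hga.continuousAt.pow _)
      (pow_ne_zero _ (hgne z hz)))
  · refine ContinuousOn.circleIntegrable hpos.le fun z hz => ContinuousAt.continuousWithinAt ?_
    have hb := hball z (Metric.sphere_subset_closedBall hz)
    exact hb.1.continuousAt.div (hb.2.1.continuousAt.pow _) (pow_ne_zero _ (hgne z hz))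

/-- Residues are invariant under a local change of coordinate: the residue of
`K(g) g' / g ^ (n + 1)` is the `n`-th Taylor coefficient of `K`. -/
theorem HasFPowerSeriesAt.eventually_circleIntegral_comp_mul_deriv_div_pow {g : ℂ → ℂ}
    (hg : AnalyticAt ℂ g 0) (hg0 : g 0 = 0) (hg' : deriv g 0 ≠ 0) (n : ℕ) {K : ℂ → ℂ}
    {p : FormalMultilinearSeries ℂ ℂ ℂ} (hK : HasFPowerSeriesAt K p 0) :
    ∀ᶠ ε in 𝓝[>] (0 : ℝ), (∮ z in C(0, ε), K (g z) * deriv g z / g z ^ (n + 1)) =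
      2 * Real.pi * I * p.coeff n := by
  induction n generalizing K p with
  | zero =>
    filter_upwards [hg.eventually_circleIntegral_comp_mul_deriv_div_pow_succ hg0 hg'
        hK.analyticAt 0,
      (hg.comp_mul_deriv hg0 hK.analyticAt.dslope_zero).eventually_circleIntegral_eq_zero,
      hg.eventually_circleIntegral_deriv_div hg0 hg'] with ε h₁ h₂ h₃
    have hp0 : p.coeff 0 = K 0 := hK.coeff_zero 1
    rw [h₁]
    simp only [zero_add, pow_one, pow_zero, div_one]
    rw [h₂, h₃, hp0]
    ring
  | succ n ih =>
    filter_upwards [hg.eventually_circleIntegral_comp_mul_deriv_div_pow_succ hg0 hg'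
        hK.analyticAt (n + 1),
      hg.eventually_circleIntegral_deriv_div_pow hg0 hg' n,
      ih hK.has_fpower_series_dslope_fslope] with ε h₁ h₂ h₃
    rw [h₁, h₂, h₃, FormalMultilinearSeries.coeff_fslope]
    ring

theorem one_sub_chi_y_coordinate {y w : ℂ} (hw : 1 - y * w ≠ 0) :
    1 - (1 - w) / (1 - y * w) = (1 - y) * w / (1 - y * w) := by
  rw [eq_div_iff hw, sub_mul, div_mul_cancel₀ _ hw]
  ring

theorem one_sub_mul_chi_y_coordinate {y w : ℂ} (hw : 1 - y * w ≠ 0) :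
    1 - y * ((1 - w) / (1 - y * w)) = (1 - y) / (1 - y * w) := by
  rw [eq_div_iff hw, sub_mul, mul_assoc, div_mul_cancel₀ _ hw]
  ring

/-- The substitution `t = (1 - w) / (1 - y w)` in one factor of the generating series. -/
theorem chi_y_factor_comp {y w t : ℂ} (hy1 : y ≠ 1) (hw : 1 - y * w ≠ 0)
    (ht : t = (1 - w) / (1 - y * w)) (k : ℕ) :
    ((1 - y * t) ^ k - (1 - t) ^ k) / ((1 - y * t) ^ k - y * (1 - t) ^ k) =
      (1 - w ^ k) / (1 - y * w ^ k) := by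
  have hy : 1 - y ≠ 0 := sub_ne_zero.2 hy1.symm
  have h₁ : 1 - y * t = (1 - y) / (1 - y * w) := ht ▸ one_sub_mul_chi_y_coordinate hw
  have h₂ : 1 - t = (1 - y) / (1 - y * w) * w := by
    rw [ht, one_sub_chi_y_coordinate hw, div_mul_eq_mul_div]
  rw [h₁, h₂, mul_pow, ← mul_div_mul_left (1 - w ^ k) (1 - y * w ^ k)
    (pow_ne_zero k (div_ne_zero hy hw))]
  congr 1 <;> ring

/-- The derivative of the coordinate change `z ↦ (1 - e^{-z}) / (1 - y e^{-z})`. -/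
theorem hasDerivAt_chi_y_coordinate {y z : ℂ} (hw : 1 - y * exp (-z) ≠ 0) :
    HasDerivAt (fun z => (1 - exp (-z)) / (1 - y * exp (-z)))
      ((1 - y) * exp (-z) / (1 - y * exp (-z)) ^ 2) z := by
  have he : HasDerivAt (fun z => exp (-z)) (-exp (-z)) z := by
    simpa using (hasDerivAt_neg z).cexp
  refine ((he.const_sub 1).div ((he.const_mul y).const_sub 1) hw).congr_deriv ?_
  congr 1
  ring

/-- The Hirzebruch `χ_{−y}`-genera of smooth complete intersections
`Y^N_{m₁,…,m_r}` in `ℂP^{N-1}`, expressed as residues (independent of the small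
radius `ε`), have generating series
`(1/((1−t)(1−yt)))·∏_j ((1−yt)^{m_j} − (1−t)^{m_j})/((1−yt)^{m_j} − y(1−t)^{m_j})`. -/
theorem chi_y_genus_complete_intersection_generating_series
    (r : ℕ) (hr : 1 ≤ r) (m : Fin r → ℕ) (hm : ∀ i, 1 ≤ m i)
    (y : ℂ) (hy0 : y ≠ 0) (hy1 : y ≠ 1) :
    ∃ χ : ℕ → ℂ,
      (∀ N : ℕ, r + 1 ≤ N →
        ∀ᶠ ε in nhdsWithin (0 : ℝ) (Set.Ioi 0),
          χ N =
            (1 - y)⁻¹ *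
              ((2 * (Real.pi : ℂ) * I)⁻¹ *
                ∮ z in C(0, ε),
                  (∏ i, (1 - exp (-((m i : ℂ) * z))) / (1 - y * exp (-((m i : ℂ) * z)))) *
                    ((1 - y * exp (-z)) / (1 - exp (-z))) ^ N)) ∧
      ∃ δ > (0 : ℝ), ∀ t : ℂ, ‖t‖ < δ →
        HasSum (fun n : ℕ => χ (n + r + 1) * t ^ (n + r))
          (1 / ((1 - t) * (1 - y * t)) *
            ∏ j, ((1 - y * t) ^ (m j) - (1 - t) ^ (m j)) /
              ((1 - y * t) ^ (m j) - y * (1 - t) ^ (m j))) := by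
  have hy : 1 - y ≠ 0 := sub_ne_zero.2 hy1.symm
  set φ : Fin r → ℂ → ℂ := fun j t =>
    ((1 - y * t) ^ m j - (1 - t) ^ m j) / ((1 - y * t) ^ m j - y * (1 - t) ^ m j) with hφ
  have hφa : ∀ j, AnalyticAt ℂ (φ j) 0 := fun j =>
    AnalyticAt.div (by fun_prop) (by fun_prop) (by simpa using hy)
  have hφ0 : ∀ j t, φ j t = t * dslope (φ j) 0 t := fun j t => by
    have h : φ j 0 = 0 := by simp [hφ]
    rw [eq_add_mul_dslope_zero (φ j) t, h, zero_add]
  set S : ℂ → ℂ := fun t => 1 / ((1 - t) * (1 - y * t)) * ∏ j, dslope (φ j) 0 t with hS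
  have hSφ : ∀ t, t ^ r * S t = 1 / ((1 - t) * (1 - y * t)) * ∏ j, φ j t := fun t => by
    rw [Finset.prod_congr rfl fun j _ => hφ0 j t, Finset.prod_mul_distrib]
    simp only [hS, Finset.prod_const, Finset.card_univ, Fintype.card_fin]
    ring
  have hSa : AnalyticAt ℂ S 0 := by
    refine AnalyticAt.mul (AnalyticAt.div (by fun_prop) (by fun_prop) (by simp)) ?_
    exact Finset.analyticAt_fun_prod _ fun j _ => (hφa j).dslope_zero
  obtain ⟨q, hq⟩ := hSa
  set g : ℂ → ℂ := fun z => (1 - exp (-z)) / (1 - y * exp (-z)) with hg_def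
  have hg0 : g 0 = 0 := by simp [hg_def]
  have hga : AnalyticAt ℂ g 0 := AnalyticAt.div (by fun_prop) (by fun_prop) (by simpa using hy)
  have hg' : deriv g 0 ≠ 0 := by
    rw [(hasDerivAt_chi_y_coordinate (y := y) (z := 0) (by simpa using hy)).deriv]
    simp [hy]
  have hden : ∀ᶠ z in 𝓝 (0 : ℂ), 1 - y * exp (-z) ≠ 0 :=
    ContinuousAt.eventually_ne (g := fun z : ℂ => 1 - y * exp (-z)) (by fun_prop)
      (by simpa using hy)
  refine ⟨fun N => q.coeff (N - (r + 1)), fun N hN => ?_, ?_⟩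
  · obtain ⟨n, rfl⟩ := Nat.exists_eq_add_of_le' hN
    filter_upwards [hq.eventually_circleIntegral_comp_mul_deriv_div_pow hga hg0 hg' n,
      eventually_forall_mem_closedBall_of_eventually_nhds
        (hden.and (hga.eventually_analyticAt_and_ne_zero hg0 hg'))] with ε hε hball
    obtain ⟨hpos, hball⟩ := hball
    have hcongr : (∮ z in C(0, ε),
        (∏ i, (1 - exp (-((m i : ℂ) * z))) / (1 - y * exp (-((m i : ℂ) * z)))) *
          ((1 - y * exp (-z)) / (1 - exp (-z))) ^ (n + (r + 1))) =
        ∮ z in C(0, ε), (1 - y) * (S (g z) * deriv g z / g z ^ (n + 1)) := by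
      refine circleIntegral.integral_congr hpos.le fun z hz => ?_
      obtain ⟨hw, -, hgne⟩ := hball z (Metric.sphere_subset_closedBall hz)
      have hgz : g z ≠ 0 := hgne (ne_zero_of_mem_sphere hpos.ne' ⟨z, hz⟩)
      have hprod : ∏ i, (1 - exp (-((m i : ℂ) * z))) / (1 - y * exp (-((m i : ℂ) * z))) =
          ∏ i, φ i (g z) := by
        refine Finset.prod_congr rfl fun i _ => ?_
        rw [← mul_neg, exp_nat_mul]
        exact (chi_y_factor_comp hy1 hw rfl (m i)).symm
      have hinv : (1 - y * exp (-z)) / (1 - exp (-z)) = (g z)⁻¹ := (inv_div _ _).symm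
      have hjac : (1 - y) * (1 / ((1 - g z) * (1 - y * g z)) * deriv g z) = 1 := by
        have he : exp (-z) ≠ 0 := exp_ne_zero _
        rw [(hasDerivAt_chi_y_coordinate hw).deriv, one_sub_chi_y_coordinate hw,
          one_sub_mul_chi_y_coordinate hw]
        field_simp
      simp only [hprod, hinv]
      calc (∏ i, φ i (g z)) * (g z)⁻¹ ^ (n + (r + 1))
          = ((1 - y) * (1 / ((1 - g z) * (1 - y * g z)) * deriv g z)) *
              (∏ i, φ i (g z)) * (g z)⁻¹ ^ (n + (r + 1)) := by rw [hjac, one_mul]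
        _ = (1 - y) * ((g z ^ r * S (g z)) * deriv g z) * (g z)⁻¹ ^ (n + (r + 1)) := by
          rw [hSφ]; ring
        _ = (1 - y) * (S (g z) * deriv g z / g z ^ (n + 1)) := by
          rw [inv_pow, show n + (r + 1) = r + (n + 1) by ring, pow_add]
          field_simp
    rw [hcongr, circleIntegral.integral_const_mul, hε, Nat.add_sub_cancel]
    have hpi : (2 * (Real.pi : ℂ) * I) ≠ 0 := two_pi_I_ne_zero
    rw [mul_left_comm (2 * (Real.pi : ℂ) * I)⁻¹, inv_mul_cancel_left₀ hy,
      inv_mul_cancel_left₀ hpi]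
  · obtain ⟨δ, hδ, hsum⟩ := Metric.eventually_nhds_iff_ball.1 (hasFPowerSeriesAt_iff.1 hq)
    refine ⟨δ, hδ, fun t ht => ?_⟩
    have h := (hsum t (by simpa using ht)).mul_left (t ^ r)
    rw [zero_add, hSφ] at h
    refine h.congr_fun fun n => ?_
    dsimp only
    rw [Nat.add_assoc, Nat.add_sub_cancel, smul_eq_mul, pow_add]
    ring
end

section
/- Fix τ ∈ ℂ with Im τ > 0, v ∈ ℂ, and integers m ≥ 1 and N ≥ 2 such that N−m is even and (N−m)·v is an integer. For 0 ≤ a, b ≤ m−1 set w_{a,b} = (−v + a + bτ + τ/2)/m, and assume θ₂(v,τ) ≠ 0, θ₂′(τ/2,τ) ≠ 0, and for all such a, b that θ(w_{a,b}, τ) ≠ 0 and θ₂(v + w_{a,b}, τ) ≠ 0. Then for all sufficiently small ε > 0, (1/(2πi)) ∮_{|z|=ε} θ(mz,τ)/θ₂(v+mz,τ) · (θ₂(v+z,τ)/θ(z,τ))^N dz = −( θ(−v+τ/2,τ)/θ₂′(τ/2,τ) ) · (1/m) · ∑_{a=0}^{m−1} ∑_{b=0}^{m−1} (−1)^{a}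 · e^{2πibv} · ( θ₂(v + w_{a,b}, τ) / θ(w_{a,b}, τ) )^N. -/
open Complex

/-- The Jacobi theta function
`θ(v,τ) = i·e^{πiτ/4}·e^{−πiv}·∏_{k≥1}(1−q^k)(1−q^{k−1}e^{2πiv})(1−q^k e^{−2πiv})`,
where `q = e^{2πiτ}`. -/
noncomputable def theta (v τ : ℂ) : ℂ :=
  I * exp ((Real.pi : ℂ) * I * τ / 4) * exp (-((Real.pi : ℂ) * I * v)) *
    ∏' k : ℕ,
      (1 - exp (2 * (Real.pi : ℂ) * I * τ) ^ (k + 1)) *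
      (1 - exp (2 * (Real.pi : ℂ) * I * τ) ^ k * exp (2 * (Real.pi : ℂ) * I * v)) *
      (1 - exp (2 * (Real.pi : ℂ) * I * τ) ^ (k + 1) * exp (-(2 * (Real.pi : ℂ) * I * v)))

/-- The theta function
`θ₂(v,τ) = ∏_{k≥1}(1−q^k)(1−q^{k−1/2}e^{2πiv})(1−q^{k−1/2}e^{−2πiv})`, where
`q = e^{2πiτ}` and `q^{k−1/2} = e^{πi(2k−1)τ}`. -/
noncomputable def theta2 (v τ : ℂ) : ℂ :=
  ∏' k : ℕ,
    (1 - exp (2 * (Real.pi : ℂ) * I * τ) ^ (k + 1)) *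
    (1 - exp ((Real.pi : ℂ) * I * (2 * (k : ℂ) + 1) * τ) * exp (2 * (Real.pi : ℂ) * I * v)) *
    (1 - exp ((Real.pi : ℂ) * I * (2 * (k : ℂ) + 1) * τ) * exp (-(2 * (Real.pi : ℂ) * I * v)))

open Filter Topology

/-- The infinite `q`-Pochhammer symbol `(x; q)_∞ = ∏_{k ≥ 0} (1 - q^k x)`. -/
noncomputable def qPochhammerInf (q x : ℂ) : ℂ := ∏' k : ℕ, (1 - q ^ k * x)

lemma summable_norm_neg_pow_mul {q : ℂ} (hq : ‖q‖ < 1) (x : ℂ) :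
    Summable fun k : ℕ => ‖-(q ^ k * x)‖ := by
  simpa using (summable_geometric_of_lt_one (norm_nonneg _) hq).mul_right ‖x‖

lemma multipliable_one_sub_pow_mul {q : ℂ} (hq : ‖q‖ < 1) (x : ℂ) :
    Multipliable fun k : ℕ => 1 - q ^ k * x := by
  simpa [sub_eq_add_neg] using multipliable_one_add_of_summable (summable_norm_neg_pow_mul hq x)

lemma qPochhammerInf_eq_mul {q : ℂ} (hq : ‖q‖ < 1) (x : ℂ) :
    qPochhammerInf q x = (1 - x) * qPochhammerInf q (q * x) := by
  have h : ∀ k : ℕ, 1 - q ^ (k + 1) * x = 1 - q ^ k * (q * x) := fun k => by ring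
  have hm : Multipliable fun k : ℕ => 1 - q ^ (k + 1) * x := by
    simpa only [h] using multipliable_one_sub_pow_mul hq (q * x)
  have key := tprod_eq_zero_mul' (f := fun k : ℕ => 1 - q ^ k * x) hm
  simp only [h, pow_zero, one_mul] at key
  exact key

lemma exists_pow_mul_eq_one_of_qPochhammerInf_eq_zero {q x : ℂ} (hq : ‖q‖ < 1)
    (h : qPochhammerInf q x = 0) : ∃ k : ℕ, q ^ k * x = 1 := by
  by_contra! hne
  refine tprod_one_add_ne_zero_of_summable (f := fun k : ℕ => -(q ^ k * x)) (fun k => ?_)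
    (summable_norm_neg_pow_mul hq x) (by simpa [qPochhammerInf, sub_eq_add_neg] using h)
  rw [← sub_eq_add_neg, sub_ne_zero]
  exact (hne k).symm

lemma differentiable_qPochhammerInf {q : ℂ} (hq : ‖q‖ < 1) :
    Differentiable ℂ (qPochhammerInf q) := by
  intro x₀
  have hs : Summable fun k : ℕ => ‖q‖ ^ k * (‖x₀‖ + 1) :=
    (summable_geometric_of_lt_one (norm_nonneg _) hq).mul_right _
  have h := hs.hasProdLocallyUniformlyOn_nat_one_add (f := fun k x => -(q ^ k * x))
    (K := Metric.ball x₀ 1) Metric.isOpen_ball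
    (.of_forall fun k x hx => by
      have : ‖x‖ ≤ ‖x₀‖ + 1 := by
        have h1 := norm_sub_norm_le x x₀
        have h2 := mem_ball_iff_norm.1 hx
        linarith
      simp only [norm_neg, norm_mul, norm_pow]
      gcongr)
    (fun k => by fun_prop)
  have hd : DifferentiableOn ℂ (fun x => ∏' k : ℕ, (1 + -(q ^ k * x))) (Metric.ball x₀ 1) :=
    h.differentiableOn (.of_forall fun _ => by
      simpa [Finset.prod_fn] using DifferentiableOn.finsetProd (fun _ _ => by fun_prop))
      Metric.isOpen_ball
  simp only [← sub_eq_add_neg] at hd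
  exact hd.differentiableAt (Metric.ball_mem_nhds _ one_pos)

/-- The period lattice `ℤ + ℤτ`. -/
def periodLattice (τ : ℂ) : AddSubgroup ℂ := AddSubgroup.closure {1, τ}

lemma mem_periodLattice {τ z : ℂ} : z ∈ periodLattice τ ↔ ∃ a b : ℤ, (a : ℂ) + b * τ = z := by
  simp [periodLattice, AddSubgroup.mem_closure_pair]

/-- The product `∏_{k ≥ 1} (1 - q^k)(1 - q^{k-1} e^{2πiu})(1 - q^k e^{-2πiu})` with
`q = e^{2πiτ}`, which is the Jacobi theta function up to an exponential factor. -/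
noncomputable def thetaProd (τ u : ℂ) : ℂ :=
  qPochhammerInf (exp (2 * Real.pi * I * τ)) (exp (2 * Real.pi * I * τ)) *
    qPochhammerInf (exp (2 * Real.pi * I * τ)) (exp (2 * Real.pi * I * u)) *
    qPochhammerInf (exp (2 * Real.pi * I * τ)) (exp (2 * Real.pi * I * (τ - u)))

lemma norm_exp_two_pi_I_mul_lt_one {τ : ℂ} (hτ : 0 < τ.im) :
    ‖exp (2 * Real.pi * I * τ)‖ < 1 :=
  UpperHalfPlane.norm_exp_two_pi_I_lt_one ⟨τ, hτ⟩



lemma tprod_one_sub_eq_thetaProd {τ : ℂ} (hτ : 0 < τ.im) (u : ℂ) :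
    ∏' k : ℕ,
      (1 - exp (2 * (Real.pi : ℂ) * I * τ) ^ (k + 1)) *
      (1 - exp (2 * (Real.pi : ℂ) * I * τ) ^ k * exp (2 * (Real.pi : ℂ) * I * u)) *
      (1 - exp (2 * (Real.pi : ℂ) * I * τ) ^ (k + 1) * exp (-(2 * (Real.pi : ℂ) * I * u))) =
    thetaProd τ u := by
  have hm := multipliable_one_sub_pow_mul (norm_exp_two_pi_I_mul_lt_one hτ)
  unfold thetaProd qPochhammerInf
  rw [← (hm _).tprod_mul (hm _), ← ((hm _).mul (hm _)).tprod_mul (hm _)]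
  refine tprod_congr fun k => ?_
  have h : exp (2 * Real.pi * I * (τ - u)) =
      exp (2 * Real.pi * I * τ) * exp (-(2 * Real.pi * I * u)) := by
    rw [← exp_add]
    ring_nf
  rw [h]
  ring

lemma theta_eq {τ : ℂ} (hτ : 0 < τ.im) (u : ℂ) :
    theta u τ = I * exp ((Real.pi : ℂ) * I * τ / 4) * exp (-((Real.pi : ℂ) * I * u)) *
      thetaProd τ u := by
  rw [theta, tprod_one_sub_eq_thetaProd hτ]

lemma theta2_eq {τ : ℂ} (hτ : 0 < τ.im) (u : ℂ) : theta2 u τ = thetaProd τ (u + τ / 2) := by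
  rw [theta2, ← tprod_one_sub_eq_thetaProd hτ]
  refine tprod_congr fun k => ?_
  simp only [← exp_nat_mul, ← exp_add]
  have h1 : Real.pi * I * (2 * k + 1) * τ + 2 * Real.pi * I * u =
    k * (2 * Real.pi * I * τ) + 2 * Real.pi * I * (u + τ / 2) := by ring
  have h2 : Real.pi * I * (2 * k + 1) * τ + -(2 * Real.pi * I * u) =
    ((k + 1 : ℕ) : ℂ) * (2 * Real.pi * I * τ) + -(2 * Real.pi * I * (u + τ / 2)) := by
    push_cast
    ring
  rw [h1, h2]

lemma thetaProd_add_one (τ u : ℂ) : thetaProd τ (u + 1) = thetaProd τ u := by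
  have h1 : exp (2 * Real.pi * I * (u + 1)) = exp (2 * Real.pi * I * u) := by
    rw [mul_add, mul_one, exp_add, exp_two_pi_mul_I, mul_one]
  have h2 : exp (2 * Real.pi * I * (τ - (u + 1))) = exp (2 * Real.pi * I * (τ - u)) := by
    rw [← sub_sub, mul_sub, mul_one, exp_sub, exp_two_pi_mul_I, div_one]
  rw [thetaProd, h1, h2, thetaProd]

lemma thetaProd_add_tau {τ : ℂ} (hτ : 0 < τ.im) (u : ℂ) :
    thetaProd τ (u + τ) = -exp (-(2 * Real.pi * I * u)) * thetaProd τ u := by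
  have hq := norm_exp_two_pi_I_mul_lt_one hτ
  have h1 := qPochhammerInf_eq_mul hq (exp (2 * Real.pi * I * u))
  have h2 := qPochhammerInf_eq_mul hq (exp (-(2 * Real.pi * I * u)))
  rw [← exp_add] at h1 h2
  have e1 : 2 * Real.pi * I * τ + 2 * Real.pi * I * u = 2 * Real.pi * I * (u + τ) := by ring
  have e2 : 2 * Real.pi * I * τ + -(2 * Real.pi * I * u) = 2 * Real.pi * I * (τ - u) := by ring
  have e3 : 2 * Real.pi * I * (τ - (u + τ)) = -(2 * Real.pi * I * u) := by ring
  rw [e1] at h1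
  rw [e2] at h2
  rw [thetaProd, thetaProd, e3, h1, h2]
  have h3 : exp (-(2 * Real.pi * I * u)) * exp (2 * Real.pi * I * u) = 1 := by
    rw [← exp_add]; simp
  linear_combination (-qPochhammerInf (exp (2 * Real.pi * I * τ)) (exp (2 * Real.pi * I * τ)) *
    qPochhammerInf (exp (2 * Real.pi * I * τ)) (exp (2 * Real.pi * I * (u + τ))) *
    qPochhammerInf (exp (2 * Real.pi * I * τ)) (exp (2 * Real.pi * I * (τ - u)))) * h3

lemma differentiable_thetaProd {τ : ℂ} (hτ : 0 < τ.im) : Differentiable ℂ (thetaProd τ) := by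
  have h := differentiable_qPochhammerInf (norm_exp_two_pi_I_mul_lt_one hτ)
  unfold thetaProd
  fun_prop

lemma analyticAt_thetaProd {τ : ℂ} (hτ : 0 < τ.im) (u : ℂ) : AnalyticAt ℂ (thetaProd τ) u :=
  (differentiable_thetaProd hτ).analyticAt u

lemma mem_periodLattice_of_thetaProd_eq_zero {τ : ℂ} (hτ : 0 < τ.im) {u : ℂ}
    (h : thetaProd τ u = 0) : u ∈ periodLattice τ := by
  have hq := norm_exp_two_pi_I_mul_lt_one hτ
  have h2pi : (2 * Real.pi * I : ℂ) ≠ 0 := two_pi_I_ne_zero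
  have key : ∀ x : ℂ, qPochhammerInf (exp (2 * Real.pi * I * τ)) (exp (2 * Real.pi * I * x)) = 0 →
      ∃ (k : ℕ) (n : ℤ), k * τ + x = n := by
    intro x hx
    obtain ⟨k, hk⟩ := exists_pow_mul_eq_one_of_qPochhammerInf_eq_zero hq hx
    rw [← exp_nat_mul, ← exp_add, exp_eq_one_iff] at hk
    obtain ⟨n, hn⟩ := hk
    exact ⟨k, n, mul_left_cancel₀ h2pi (by linear_combination hn)⟩
  rw [mem_periodLattice]
  rcases mul_eq_zero.1 h with h | h
  · rcases mul_eq_zero.1 h with h | h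
    · obtain ⟨k, n, hkn⟩ := key τ h
      have him := congrArg Complex.im hkn
      simp at him
      have : (0 : ℝ) < k * τ.im + τ.im := by positivity
      exact absurd him this.ne'
    · obtain ⟨k, n, hkn⟩ := key u h
      exact ⟨n, -k, by push_cast; linear_combination -hkn⟩
  · obtain ⟨k, n, hkn⟩ := key _ h
    exact ⟨-n, k + 1, by push_cast; linear_combination hkn⟩

lemma thetaProd_zero {τ : ℂ} (hτ : 0 < τ.im) : thetaProd τ 0 = 0 := by
  have h : qPochhammerInf (exp (2 * Real.pi * I * τ)) 1 = 0 := by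
    rw [qPochhammerInf_eq_mul (norm_exp_two_pi_I_mul_lt_one hτ)]; simp
  simp [thetaProd, h]

lemma thetaProd_eq_zero_add_iff {τ : ℂ} (hτ : 0 < τ.im) {l : ℂ} (hl : l ∈ periodLattice τ) :
    ∀ u, thetaProd τ (u + l) = 0 ↔ thetaProd τ u = 0 := by
  induction hl using AddSubgroup.closure_induction with
  | mem x hx =>
    rintro u
    rcases hx with rfl | rfl
    · rw [thetaProd_add_one]
    · simp [thetaProd_add_tau hτ]
  | zero => simp
  | add x y _ _ hx hy => intro u; rw [← add_assoc, hy, hx]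
  | neg x _ hx => intro u; simpa using (hx (u + -x)).symm

lemma thetaProd_eq_zero_iff {τ : ℂ} (hτ : 0 < τ.im) {u : ℂ} :
    thetaProd τ u = 0 ↔ u ∈ periodLattice τ :=
  ⟨mem_periodLattice_of_thetaProd_eq_zero hτ, fun h => by
    simpa [thetaProd_zero hτ] using thetaProd_eq_zero_add_iff hτ h 0⟩

lemma thetaProd_eventually_ne_zero {τ : ℂ} (hτ : 0 < τ.im) (p : ℂ) :
    ∀ᶠ z in 𝓝[≠] p, thetaProd τ z ≠ 0 := by
  refine (analyticAt_thetaProd hτ p).eventually_eq_zero_or_eventually_ne_zero.resolve_left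
    fun h => ?_
  have h0 := AnalyticOnNhd.eqOn_zero_of_preconnected_of_eventuallyEq_zero
    (fun z _ => analyticAt_thetaProd hτ z) isPreconnected_univ (Set.mem_univ p) h
  obtain ⟨a, b, hab⟩ := mem_periodLattice.1
    (mem_periodLattice_of_thetaProd_eq_zero hτ (h0 (Set.mem_univ (τ / 2))))
  have him := congrArg Complex.im hab
  simp at him
  have : (2 * b - 1 : ℝ) * τ.im = 0 := by linarith
  have : (2 * b - 1 : ℝ) = 0 := (mul_eq_zero.1 this).resolve_right hτ.ne'
  have : 2 * b - 1 = 0 := by exact_mod_cast this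
  omega

lemma tendsto_add_const_punctured (p c : ℂ) :
    Tendsto (fun z => z + c) (𝓝[≠] p) (𝓝[≠] (p + c)) := by
  refine tendsto_nhdsWithin_iff.2 ⟨?_, ?_⟩
  · exact ((continuous_add_const c).tendsto p).mono_left nhdsWithin_le_nhds
  · filter_upwards [self_mem_nhdsWithin] with z hz
    simpa using hz

/-- `G` agrees on a punctured neighbourhood of `p` with a function analytic at `p`, i.e. the
singularity of `G` at `p` is removable. -/
def HasAnalyticExtensionAt (G : ℂ → ℂ) (p : ℂ) : Prop :=
  ∃ g : ℂ → ℂ, AnalyticAt ℂ g p ∧ G =ᶠ[𝓝[≠] p] g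

lemma AnalyticAt.hasAnalyticExtensionAt {G : ℂ → ℂ} {p : ℂ} (h : AnalyticAt ℂ G p) :
    HasAnalyticExtensionAt G p :=
  ⟨G, h, EventuallyEq.rfl⟩

namespace HasAnalyticExtensionAt

variable {F G : ℂ → ℂ} {p : ℂ}

lemma congr (hF : HasAnalyticExtensionAt F p) (h : G =ᶠ[𝓝[≠] p] F) :
    HasAnalyticExtensionAt G p :=
  let ⟨g, hg, hFg⟩ := hF
  ⟨g, hg, h.trans hFg⟩

lemma add (hF : HasAnalyticExtensionAt F p) (hG : HasAnalyticExtensionAt G p) :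
    HasAnalyticExtensionAt (fun z => F z + G z) p :=
  let ⟨f, hf, hFf⟩ := hF
  let ⟨g, hg, hGg⟩ := hG
  ⟨fun z => f z + g z, hf.add hg, hFf.add hGg⟩

lemma sub (hF : HasAnalyticExtensionAt F p) (hG : HasAnalyticExtensionAt G p) :
    HasAnalyticExtensionAt (fun z => F z - G z) p :=
  let ⟨f, hf, hFf⟩ := hF
  let ⟨g, hg, hGg⟩ := hG
  ⟨fun z => f z - g z, hf.sub hg, hFf.sub hGg⟩

lemma const_mul (hF : HasAnalyticExtensionAt F p) (c : ℂ) :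
    HasAnalyticExtensionAt (fun z => c * F z) p :=
  let ⟨f, hf, hFf⟩ := hF
  ⟨fun z => c * f z, analyticAt_const.mul hf, hFf.mono fun z hz => by simp only [hz]⟩

lemma sum {ι : Type*} {s : Finset ι} {F : ι → ℂ → ℂ}
    (h : ∀ i ∈ s, HasAnalyticExtensionAt (F i) p) :
    HasAnalyticExtensionAt (fun z => ∑ i ∈ s, F i z) p := by
  classical
  induction s using Finset.induction_on with
  | empty => simpa using (analyticAt_const (v := (0 : ℂ))).hasAnalyticExtensionAt
  | insert i s hi ih =>
    simp only [Finset.sum_insert hi]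
    exact (h i (Finset.mem_insert_self i s)).add
      (ih fun j hj => h j (Finset.mem_insert_of_mem hj))

lemma comp_add_const (c : ℂ) (hF : HasAnalyticExtensionAt F (p + c)) :
    HasAnalyticExtensionAt (fun z => F (z + c)) p := by
  obtain ⟨f, hf, hFf⟩ := hF
  exact ⟨fun z => f (z + c), hf.comp_of_eq (by fun_prop) rfl,
    (tendsto_add_const_punctured p c).eventually hFf⟩

lemma tendsto_limUnder (h : HasAnalyticExtensionAt G p) :
    Tendsto G (𝓝[≠] p) (𝓝 (limUnder (𝓝[≠] p) G)) := by
  obtain ⟨g, hg, hGg⟩ := h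
  exact tendsto_nhds_limUnder
    ⟨g p, (hg.continuousAt.tendsto.mono_left nhdsWithin_le_nhds).congr' hGg.symm⟩

lemma analyticAt_limUnder (h : HasAnalyticExtensionAt G p) :
    AnalyticAt ℂ (fun z => limUnder (𝓝[≠] z) G) p := by
  obtain ⟨g, hg, hGg⟩ := h
  refine hg.congr ?_
  have h2 : ∀ᶠ z in 𝓝 p, z ≠ p → G z = g z := eventually_nhdsWithin_iff.1 hGg
  filter_upwards [h2.eventually_nhds, hg.eventually_analyticAt] with z hz hgz
  have hz' : G =ᶠ[𝓝[≠] z] g := by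
    rcases eq_or_ne z p with rfl | hne
    · exact hGg
    · refine Eventually.filter_mono nhdsWithin_le_nhds ?_
      filter_upwards [hz, isOpen_ne.mem_nhds hne] with y hy hyp using hy hyp
  exact (((hgz.continuousAt.tendsto.mono_left nhdsWithin_le_nhds).congr' hz'.symm).limUnder_eq).symm

end HasAnalyticExtensionAt

lemma AnalyticAt.dslope {f : ℂ → ℂ} {p : ℂ} (hf : AnalyticAt ℂ f p) :
    AnalyticAt ℂ (dslope f p) p :=
  let ⟨_, hq⟩ := hf
  hq.has_fpower_series_dslope_fslope.analyticAt

lemma hasAnalyticExtensionAt_slope {f : ℂ → ℂ} {p : ℂ} (hf : AnalyticAt ℂ f p) :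
    HasAnalyticExtensionAt (fun z => (f z - f p) / (z - p)) p := by
  refine ⟨_, hf.dslope, ?_⟩
  filter_upwards [self_mem_nhdsWithin] with z hz
  rw [dslope_of_ne _ hz, slope_def_field]

/-- A quotient with a simple zero of the denominator has the expected principal part. -/
lemma hasAnalyticExtensionAt_div_sub {f g : ℂ → ℂ} {p : ℂ} (hf : AnalyticAt ℂ f p)
    (hg : AnalyticAt ℂ g p) (hgp : g p = 0) (hg' : deriv g p ≠ 0) :
    HasAnalyticExtensionAt (fun z => f z / g z - f p / deriv g p / (z - p)) p := by
  have hD : dslope g p p = deriv g p := dslope_same g p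
  have hh := hasAnalyticExtensionAt_slope (hf.fun_div hg.dslope (hD ▸ hg'))
  refine hh.congr ?_
  filter_upwards [self_mem_nhdsWithin] with z hz
  have hgz : g z = (z - p) * dslope g p z := by
    have := sub_smul_dslope g p z
    rw [hgp, sub_zero, smul_eq_mul] at this
    exact this.symm
  rw [hD, sub_div, hgz, div_mul_eq_div_div_swap]

lemma exists_principal_part {n : ℕ} {F : ℂ → ℂ}
    (h : HasAnalyticExtensionAt (fun z => z ^ n * F z) 0) :
    ∃ a : ℕ → ℂ, HasAnalyticExtensionAt
      (fun z => F z - ∑ k ∈ Finset.range n, a k * (z ^ (k + 1))⁻¹) 0 := by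
  induction n generalizing F with
  | zero => exact ⟨0, by simpa using h⟩
  | succ n ih =>
    obtain ⟨g, hg, hFg⟩ := h
    have h1 : HasAnalyticExtensionAt
        (fun z => z ^ n * (F z - g 0 * (z ^ (n + 1))⁻¹)) 0 := by
      refine (hasAnalyticExtensionAt_slope hg).congr ?_
      filter_upwards [hFg, self_mem_nhdsWithin] with z hz hz0
      have hz0 : z ≠ 0 := hz0
      rw [← hz]
      field_simp
      ring
    obtain ⟨a, ha⟩ := ih h1
    refine ⟨Function.update a n (g 0), ha.congr (.of_forall fun z => ?_)⟩
    have hs : ∑ k ∈ Finset.range n, Function.update a n (g 0) k * (z ^ (k + 1))⁻¹ =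
        ∑ k ∈ Finset.range n, a k * (z ^ (k + 1))⁻¹ :=
      Finset.sum_congr rfl fun k hk => by
        rw [Function.update_of_ne (Finset.mem_range.1 hk).ne]
    simp only [Finset.sum_range_succ, hs, Function.update_self]
    ring

lemma MeromorphicAt.exists_principal_part {F : ℂ → ℂ} (h : MeromorphicAt F 0) :
    ∃ (n : ℕ) (a : ℕ → ℂ), HasAnalyticExtensionAt
      (fun z => F z - ∑ k ∈ Finset.range (n + 1), a k * (z ^ (k + 1))⁻¹) 0 := by
  obtain ⟨n, hn⟩ := h
  refine ⟨n, _root_.exists_principal_part (AnalyticAt.hasAnalyticExtensionAt ?_)⟩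
  have h2 := (analyticAt_id (𝕜 := ℂ) (z := (0 : ℂ))).mul hn
  refine h2.congr (.of_forall fun z => ?_)
  simp [pow_succ']
  ring

lemma eventually_circleIntegral_eq {F : ℂ → ℂ} {n : ℕ} {a : ℕ → ℂ}
    (h : HasAnalyticExtensionAt
      (fun z => F z - ∑ k ∈ Finset.range (n + 1), a k * (z ^ (k + 1))⁻¹) 0) :
    ∀ᶠ ε in 𝓝[>] (0 : ℝ), (2 * (Real.pi : ℂ) * I)⁻¹ * (∮ z in C(0, ε), F z) = a 0 := by
  obtain ⟨g, hg, hFg⟩ := h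
  have h1 := hg.eventually_analyticAt.and (eventually_nhdsWithin_iff.1 hFg)
  obtain ⟨δ, hδ, hball⟩ := Metric.eventually_nhds_iff_ball.1 h1
  filter_upwards [Ioo_mem_nhdsGT hδ] with ε hε
  have hε0 : ε ≠ 0 := hε.1.ne'
  have hsub : Metric.closedBall (0 : ℂ) ε ⊆ Metric.ball 0 δ :=
    Metric.closedBall_subset_ball hε.2
  have hgd : DifferentiableOn ℂ g (Metric.closedBall 0 ε) := fun z hz =>
    (hball z (hsub hz)).1.differentiableAt.differentiableWithinAt
  have hne : ∀ z ∈ Metric.sphere (0 : ℂ) ε, z ≠ 0 := fun z hz => by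
    rintro rfl
    simp at hz
    exact hε0 hz.symm
  have hF : (∮ z in C(0, ε), F z) =
      ∮ z in C(0, ε), (g z + ∑ k ∈ Finset.range (n + 1), a k * (z ^ (k + 1))⁻¹) := by
    refine circleIntegral.integral_congr hε.1.le fun z hz => ?_
    have := (hball z (hsub (Metric.sphere_subset_closedBall hz))).2 (hne z hz)
    linear_combination this
  have hgint : (∮ z in C(0, ε), g z) = 0 :=
    (hgd.diffContOnCl_ball subset_rfl).circleIntegral_eq_zero hε.1.le
  have hci : ∀ k, CircleIntegrable (fun z : ℂ => a k * (z ^ (k + 1))⁻¹) 0 ε := fun k =>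
    ContinuousOn.circleIntegrable hε.1.le <| continuousOn_const.mul <|
      (continuousOn_pow _).inv₀ fun z hz => pow_ne_zero _ (hne z hz)
  have hk : ∀ k ∈ Finset.range n,
      (∮ z in C(0, ε), a (k + 1) * (z ^ (k + 1 + 1))⁻¹) = 0 := fun k _ => by
    rw [circleIntegral.integral_const_mul]
    have := circleIntegral.integral_sub_zpow_of_ne (n := -((k + 1 + 1 : ℕ) : ℤ))
      (by push_cast; omega) 0 0 ε
    simp only [sub_zero, zpow_neg, zpow_natCast] at this
    rw [this, mul_zero]
  have h0 : (∮ z in C(0, ε), a 0 * (z ^ (0 + 1))⁻¹) = 2 * Real.pi * I * a 0 := by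
    rw [circleIntegral.integral_const_mul]
    have := circleIntegral.integral_sub_center_inv (0 : ℂ) hε0
    simp only [sub_zero] at this
    simp only [zero_add, pow_one]
    rw [this, mul_comm]
  rw [hF, circleIntegral.integral_add
    ((hgd.continuousOn.mono Metric.sphere_subset_closedBall).circleIntegrable hε.1.le)
    (ContinuousOn.circleIntegrable hε.1.le (by
      refine continuousOn_finsetSum _ fun k _ => ?_
      exact continuousOn_const.mul <|
        (continuousOn_pow _).inv₀ fun z hz => pow_ne_zero _ (hne z hz))),
    circleIntegral.integral_fun_sum fun k _ => hci k, Finset.sum_range_succ', hgint,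
    Finset.sum_eq_zero hk, h0, zero_add, zero_add, inv_mul_cancel_left₀ two_pi_I_ne_zero]

lemma Differentiable.exists_const_of_doubly_periodic {τ : ℂ} (hτ : 0 < τ.im) {f : ℂ → ℂ}
    (hf : Differentiable ℂ f) (h1 : ∀ z, f (z + 1) = f z) (h2 : ∀ z, f (z + τ) = f z) :
    ∃ c, ∀ z, f z = c := by
  refine hf.exists_const_forall_eq_of_bounded ?_
  have hK : IsCompact (Set.Icc (0 : ℝ) 1 ×ℂ Set.Icc (0 : ℝ) τ.im) :=
    isCompact_Icc.reProdIm isCompact_Icc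
  refine (hK.image hf.continuous).isBounded.subset ?_
  rintro _ ⟨z, rfl⟩
  have p1 : Function.Periodic f 1 := h1
  have p2 : Function.Periodic f τ := h2
  set w := z - ⌊z.im / τ.im⌋ * τ with hw
  refine ⟨w - ⌊w.re⌋ * 1, ?_, ?_⟩
  · have hwim : w.im = z.im - ⌊z.im / τ.im⌋ * τ.im := by simp [hw]
    have e1 := Int.floor_le (z.im / τ.im)
    have e2 := Int.lt_floor_add_one (z.im / τ.im)
    rw [le_div_iff₀ hτ] at e1
    rw [div_lt_iff₀ hτ] at e2
    have e3 := Int.floor_le w.re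
    have e4 := Int.lt_floor_add_one w.re
    refine mem_reProdIm.2 ⟨⟨?_, ?_⟩, ⟨?_, ?_⟩⟩ <;> simp [hwim, -Int.self_sub_floor] <;> linarith
  · rw [p1.sub_int_mul_eq, hw, p2.sub_int_mul_eq]

lemma eq_zero_of_entire_quasi_periodic {τ c : ℂ} (hτ : 0 < τ.im) {f : ℂ → ℂ}
    (hf : Differentiable ℂ f) (h1 : ∀ z, f (z + 1) = f z) (h2 : ∀ z, f (z + τ) = f z + c) :
    c = 0 := by
  obtain ⟨k, hk⟩ := (hf.deriv).exists_const_of_doubly_periodic hτ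
    (fun z => by rw [← deriv_comp_add_const]; simp only [h1])
    (fun z => by rw [← deriv_comp_add_const]; simp only [h2, deriv_add_const])
  have hlin : ∀ z, f z - k * z = f 0 - k * 0 := fun z =>
    is_const_of_deriv_eq_zero (f := fun z => f z - k * z) (by fun_prop) (fun x => by
      rw [deriv_fun_sub hf.differentiableAt (by fun_prop), hk, deriv_const_mul _ (by fun_prop)]
      simp) z 0
  have hk0 : k = 0 := by
    have e1 := hlin 1
    have e2 := h1 0
    rw [zero_add] at e2
    linear_combination e2 - e1
  have e1 := hlin τ
  have e2 := h2 0
  rw [zero_add] at e2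
  rw [hk0] at e1
  linear_combination e1 - e2

/-- The logarithmic derivative of `thetaProd` and its normalized iterated derivatives:
`thetaZeta τ k` is holomorphic off the period lattice, with principal part `z⁻¹ ^ (k + 1)` at `0`. -/
noncomputable def thetaZeta (τ : ℂ) : ℕ → ℂ → ℂ
  | 0 => fun z => deriv (thetaProd τ) z / thetaProd τ z
  | k + 1 => fun z => -((k : ℂ) + 1)⁻¹ * deriv (thetaZeta τ k) z

lemma thetaZeta_succ (τ : ℂ) (k : ℕ) (z : ℂ) :
    thetaZeta τ (k + 1) z = -((k : ℂ) + 1)⁻¹ * deriv (thetaZeta τ k) z := rfl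

lemma analyticAt_thetaZeta {τ : ℂ} (hτ : 0 < τ.im) (k : ℕ) {z : ℂ}
    (hz : z ∉ periodLattice τ) : AnalyticAt ℂ (thetaZeta τ k) z := by
  induction k with
  | zero =>
    exact (analyticAt_thetaProd hτ z).deriv.fun_div (analyticAt_thetaProd hτ z)
      (mt (thetaProd_eq_zero_iff hτ).1 hz)
  | succ k ih => exact analyticAt_const.mul ih.deriv

lemma hasAnalyticExtensionAt_thetaZeta_sub {τ : ℂ} (hτ : 0 < τ.im)
    (h' : deriv (thetaProd τ) 0 ≠ 0) (k : ℕ) :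
    HasAnalyticExtensionAt (fun z => thetaZeta τ k z - (z ^ (k + 1))⁻¹) 0 := by
  induction k with
  | zero =>
    have := hasAnalyticExtensionAt_div_sub (analyticAt_thetaProd hτ 0).deriv
      (analyticAt_thetaProd hτ 0) (thetaProd_zero hτ) h'
    simpa [div_self h', thetaZeta] using this
  | succ k ih =>
    obtain ⟨g, hg, hZg⟩ := ih
    refine ⟨fun z => -((k : ℂ) + 1)⁻¹ * deriv g z, analyticAt_const.mul hg.deriv, ?_⟩
    have h2 := eventually_nhdsWithin_iff.1 hZg
    rw [EventuallyEq, eventually_nhdsWithin_iff]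
    filter_upwards [h2.eventually_nhds, hg.eventually_analyticAt] with z hz hgz hz0
    have hz0 : z ≠ 0 := hz0
    have hev : thetaZeta τ k =ᶠ[𝓝 z] fun y => g y + (y ^ (k + 1))⁻¹ := by
      filter_upwards [hz, isOpen_ne.mem_nhds hz0] with y hy hy0
      linear_combination hy hy0
    have hd : HasDerivAt (fun y : ℂ => (y ^ (k + 1))⁻¹)
        (-(((k + 1 : ℕ) : ℂ) * z ^ k) / (z ^ (k + 1)) ^ 2) z := by
      simpa using (hasDerivAt_pow (k + 1) z).fun_inv (pow_ne_zero _ hz0)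
    have hk : (k : ℂ) + 1 ≠ 0 := Nat.cast_add_one_ne_zero k
    simp only [thetaZeta]
    rw [hev.deriv_eq, (hgz.differentiableAt.hasDerivAt.fun_add hd).deriv]
    push_cast
    field_simp
    ring

lemma deriv_thetaProd_add_one (τ z : ℂ) :
    deriv (thetaProd τ) (z + 1) = deriv (thetaProd τ) z := by
  rw [← deriv_comp_add_const]
  simp only [thetaProd_add_one]

lemma deriv_thetaProd_add_tau {τ : ℂ} (hτ : 0 < τ.im) (z : ℂ) :
    deriv (thetaProd τ) (z + τ) = -exp (-(2 * Real.pi * I * z)) *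
      (deriv (thetaProd τ) z - 2 * Real.pi * I * thetaProd τ z) := by
  rw [← deriv_comp_add_const]
  simp only [thetaProd_add_tau hτ]
  have he : HasDerivAt (fun z : ℂ => -exp (-(2 * Real.pi * I * z)))
      (-(exp (-(2 * Real.pi * I * z)) * -(2 * Real.pi * I * 1))) z :=
    (((hasDerivAt_id z).const_mul (2 * Real.pi * I : ℂ)).fun_neg.cexp).fun_neg
  rw [(he.fun_mul (differentiable_thetaProd hτ z).hasDerivAt).deriv]
  ring

lemma thetaZeta_add_one (τ : ℂ) (k : ℕ) (z : ℂ) : thetaZeta τ k (z + 1) = thetaZeta τ k z := by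
  induction k generalizing z with
  | zero => simp only [thetaZeta, thetaProd_add_one, deriv_thetaProd_add_one]
  | succ k ih =>
    simp only [thetaZeta]
    rw [← deriv_comp_add_const]
    simp only [ih]

lemma thetaZeta_zero_add_tau {τ : ℂ} (hτ : 0 < τ.im) {z : ℂ} (hz : thetaProd τ z ≠ 0) :
    thetaZeta τ 0 (z + τ) = thetaZeta τ 0 z - 2 * Real.pi * I := by
  have := exp_ne_zero (-(2 * Real.pi * I * z))
  simp only [thetaZeta, thetaProd_add_tau hτ, deriv_thetaProd_add_tau hτ]
  field_simp

lemma thetaZeta_succ_add_tau {τ : ℂ} (hτ : 0 < τ.im) (k : ℕ) {z : ℂ} (hz : thetaProd τ z ≠ 0) :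
    thetaZeta τ (k + 1) (z + τ) = thetaZeta τ (k + 1) z := by
  have hopen : ∀ {z : ℂ}, thetaProd τ z ≠ 0 → ∀ᶠ y in 𝓝 z, thetaProd τ y ≠ 0 := fun hz =>
    (differentiable_thetaProd hτ).continuous.continuousAt.eventually_ne hz
  induction k generalizing z with
  | zero =>
    simp only [thetaZeta_succ]
    rw [← deriv_comp_add_const, EventuallyEq.deriv_eq
      ((hopen hz).mono fun y hy => thetaZeta_zero_add_tau hτ hy), deriv_sub_const_fun]
  | succ k ih =>
    rw [thetaZeta_succ, thetaZeta_succ _ (k + 1)]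
    rw [← deriv_comp_add_const, EventuallyEq.deriv_eq ((hopen hz).mono fun y hy => ih hy)]

lemma hasAnalyticExtensionAt_add_iff {τ c : ℂ} {G : ℂ → ℂ} (h1 : ∀ z, G (z + 1) = G z)
    (h2 : ∀ p, ∀ᶠ z in 𝓝[≠] p, G (z + τ) = G z + c) {l : ℂ} (hl : l ∈ periodLattice τ) :
    ∀ p, HasAnalyticExtensionAt G (p + l) ↔ HasAnalyticExtensionAt G p := by
  induction hl using AddSubgroup.closure_induction with
  | mem x hx =>
    intro p
    rcases hx with rfl | rfl
    · constructor <;> intro h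
      · simpa only [h1] using h.comp_add_const
      · have := (show HasAnalyticExtensionAt G (p + 1 + -1) by simpa using h).comp_add_const
        refine this.congr (.of_forall fun z => ?_)
        simpa using h1 (z + -1)
    · constructor <;> intro h
      · refine (h.comp_add_const.sub
          (analyticAt_const (v := c)).hasAnalyticExtensionAt).congr ?_
        filter_upwards [h2 p] with z hz
        rw [hz, add_sub_cancel_right]
      · have := (show HasAnalyticExtensionAt (fun z => G z + c) (p + x + -x) by
          simpa using h.add (analyticAt_const (v := c)).hasAnalyticExtensionAt).comp_add_const
        refine this.congr ?_
        have ht := tendsto_add_const_punctured (p + x) (-x)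
        rw [add_neg_cancel_right] at ht
        filter_upwards [ht.eventually (h2 p)] with z hz
        rw [← hz, neg_add_cancel_right]
  | zero => simp
  | add x y _ _ hx hy => intro p; rw [← add_assoc, hy, hx]
  | neg x _ hx => intro p; simpa using (hx (p + -x)).symm

lemma eq_zero_of_quasi_periodic_of_removable {τ c : ℂ} (hτ : 0 < τ.im) {G : ℂ → ℂ}
    (h1 : ∀ z, G (z + 1) = G z) (h2 : ∀ p, ∀ᶠ z in 𝓝[≠] p, G (z + τ) = G z + c)
    (hG : ∀ p, HasAnalyticExtensionAt G p) : c = 0 := by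
  refine eq_zero_of_entire_quasi_periodic hτ (f := fun z => limUnder (𝓝[≠] z) G)
    (fun p => (hG p).analyticAt_limUnder.differentiableAt) (fun p => ?_) (fun p => ?_)
  · refine tendsto_nhds_unique
      ((hG (p + 1)).tendsto_limUnder.comp (tendsto_add_const_punctured p 1)) ?_
    exact (hG p).tendsto_limUnder.congr fun z => (h1 z).symm
  · refine tendsto_nhds_unique
      ((hG (p + τ)).tendsto_limUnder.comp (tendsto_add_const_punctured p τ)) ?_
    exact ((hG p).tendsto_limUnder.add_const c).congr' ((h2 p).mono fun z hz => hz.symm)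

/-- The residues of an elliptic function sum to zero, for a function with finitely many simple
poles `w j` modulo the lattice besides a pole of arbitrary order at the origin. -/
theorem eventually_circleIntegral_eq_neg_sum_residues {τ : ℂ} (hτ : 0 < τ.im)
    (h' : deriv (thetaProd τ) 0 ≠ 0) {ι : Type*} {s : Finset ι} {w r : ι → ℂ} {F : ℂ → ℂ}
    (h1 : ∀ z, F (z + 1) = F z) (h2 : ∀ z, F (z + τ) = F z)
    (hw : ∀ j ∈ s, w j ∉ periodLattice τ)
    (hww : ∀ i ∈ s, ∀ j ∈ s, i ≠ j → w i - w j ∉ periodLattice τ)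
    (hpole : ∀ j ∈ s, HasAnalyticExtensionAt (fun z => F z - r j / (z - w j)) (w j))
    (hmer : MeromorphicAt F 0)
    (hF : ∀ p, p ∉ periodLattice τ → (∀ j ∈ s, p - w j ∉ periodLattice τ) → AnalyticAt ℂ F p) :
    ∀ᶠ ε in 𝓝[>] (0 : ℝ),
      (2 * (Real.pi : ℂ) * I)⁻¹ * (∮ z in C(0, ε), F z) = -∑ j ∈ s, r j := by
  obtain ⟨n, a, ha⟩ := hmer.exists_principal_part
  filter_upwards [eventually_circleIntegral_eq ha] with ε hε
  rw [hε]
  set A : ℂ → ℂ := fun z => ∑ k ∈ Finset.range (n + 1), a k * thetaZeta τ k z with hA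
  set B : ℂ → ℂ := fun z => ∑ j ∈ s, r j * thetaZeta τ 0 (z - w j) with hB
  have hBan : ∀ j ∈ s, ∀ p, p - w j ∉ periodLattice τ →
      HasAnalyticExtensionAt (fun z => r j * thetaZeta τ 0 (z - w j)) p := fun j _ p hp =>
    ((analyticAt_thetaZeta hτ 0 hp).comp_of_eq (f := fun z => z - w j)
      (by fun_prop) rfl).hasAnalyticExtensionAt.const_mul _
  have hAan : ∀ p, p ∉ periodLattice τ → HasAnalyticExtensionAt A p := fun p hp =>
    HasAnalyticExtensionAt.sum fun k _ =>
      (analyticAt_thetaZeta hτ k hp).hasAnalyticExtensionAt.const_mul _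
  have g1 : ∀ z, F (z + 1) - A (z + 1) - B (z + 1) = F z - A z - B z := fun z => by
    simp only [hA, hB, h1, thetaZeta_add_one, add_sub_right_comm z 1]
  have g2 : ∀ p, ∀ᶠ z in 𝓝[≠] p, F (z + τ) - A (z + τ) - B (z + τ) =
      F z - A z - B z + 2 * Real.pi * I * (a 0 + ∑ j ∈ s, r j) := fun p => by
    have hev : ∀ᶠ z in 𝓝[≠] p, ∀ j ∈ s, thetaProd τ (z - w j) ≠ 0 := by
      rw [Finset.eventually_all]
      intro j _
      simp only [sub_eq_add_neg]
      exact (tendsto_add_const_punctured p (-w j)).eventually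
        (thetaProd_eventually_ne_zero hτ (p + -w j))
    filter_upwards [hev, thetaProd_eventually_ne_zero hτ p] with z hz hz0
    have eA : A (z + τ) = A z - 2 * Real.pi * I * a 0 := by
      simp only [hA, Finset.sum_range_succ', thetaZeta_succ_add_tau hτ _ hz0,
        thetaZeta_zero_add_tau hτ hz0]
      ring
    have eB : B (z + τ) = B z - 2 * Real.pi * I * ∑ j ∈ s, r j := by
      simp only [hB, Finset.mul_sum, ← Finset.sum_sub_distrib]
      refine Finset.sum_congr rfl fun j hj => ?_
      rw [add_sub_right_comm, thetaZeta_zero_add_tau hτ (hz j hj)]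
      ring
    rw [h2, eA, eB]
    ring
  have hz : HasAnalyticExtensionAt (fun z => F z - A z - B z) 0 := by
    have hA0 : HasAnalyticExtensionAt (fun z => ∑ k ∈ Finset.range (n + 1),
        a k * (thetaZeta τ k z - (z ^ (k + 1))⁻¹)) 0 :=
      HasAnalyticExtensionAt.sum fun k _ =>
        (hasAnalyticExtensionAt_thetaZeta_sub hτ h' k).const_mul _
    have hB0 : HasAnalyticExtensionAt B 0 := HasAnalyticExtensionAt.sum fun j hj =>
      hBan j hj 0 (by simpa using hw j hj)
    refine ((ha.sub hA0).sub hB0).congr (.of_forall fun z => ?_)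
    simp only [mul_sub, Finset.sum_sub_distrib, hA]
    ring
  have hwj : ∀ j ∈ s, HasAnalyticExtensionAt (fun z => F z - A z - B z) (w j) := fun j hj => by
    classical
    have hZ : HasAnalyticExtensionAt
        (fun z => r j * (thetaZeta τ 0 (z + -w j) - ((z + -w j) ^ (0 + 1))⁻¹)) (w j) :=
      (HasAnalyticExtensionAt.comp_add_const (-w j)
        (F := fun z => thetaZeta τ 0 z - (z ^ (0 + 1))⁻¹)
        (by simpa using hasAnalyticExtensionAt_thetaZeta_sub hτ h' 0)).const_mul _
    have hB' : HasAnalyticExtensionAt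
        (fun z => ∑ i ∈ s.erase j, r i * thetaZeta τ 0 (z - w i)) (w j) :=
      HasAnalyticExtensionAt.sum fun i hi => hBan i (Finset.mem_of_mem_erase hi) _
        (hww j hj i (Finset.mem_of_mem_erase hi) (Finset.ne_of_mem_erase hi).symm)
    refine ((((hpole j hj).sub (hAan _ (hw j hj))).sub hZ).sub hB').congr
      (.of_forall fun z => ?_)
    simp only [hB, ← Finset.add_sum_erase s _ hj, zero_add, pow_one, ← sub_eq_add_neg]
    ring
  have hG : ∀ p, HasAnalyticExtensionAt (fun z => F z - A z - B z) p := fun p => by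
    have hiff := @hasAnalyticExtensionAt_add_iff τ _ (fun z => F z - A z - B z) g1 g2
    by_cases hp : p ∈ periodLattice τ
    · simpa using (hiff hp 0).2 hz
    by_cases hpw : ∃ j ∈ s, p - w j ∈ periodLattice τ
    · obtain ⟨j, hj, hl⟩ := hpw
      simpa using (hiff hl (w j)).2 (hwj j hj)
    · push Not at hpw
      exact ((hF p hp hpw).hasAnalyticExtensionAt.sub (hAan p hp)).sub
        (HasAnalyticExtensionAt.sum fun j hj => hBan j hj p (hpw j hj))
  have hc := eq_zero_of_quasi_periodic_of_removable hτ g1 g2 hG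
  exact eq_neg_of_add_eq_zero_left ((mul_eq_zero.1 hc).resolve_left two_pi_I_ne_zero)

lemma theta_add_one {τ : ℂ} (hτ : 0 < τ.im) (u : ℂ) : theta (u + 1) τ = -theta u τ := by
  have h : exp (-((Real.pi : ℂ) * I * (u + 1))) = -exp (-((Real.pi : ℂ) * I * u)) := by
    rw [mul_add, mul_one, neg_add, exp_add, exp_neg (Real.pi * I), exp_pi_mul_I]
    norm_num
  rw [theta_eq hτ, theta_eq hτ, thetaProd_add_one, h]
  ring

lemma theta2_add_one {τ : ℂ} (hτ : 0 < τ.im) (u : ℂ) : theta2 (u + 1) τ = theta2 u τ := by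
  rw [theta2_eq hτ, theta2_eq hτ, add_right_comm, thetaProd_add_one]

lemma theta_add_tau {τ : ℂ} (hτ : 0 < τ.im) (u : ℂ) :
    theta (u + τ) τ = -exp (-(Real.pi * I * τ)) * exp (-(2 * Real.pi * I * u)) * theta u τ := by
  rw [theta_eq hτ, theta_eq hτ, thetaProd_add_tau hτ, mul_add, neg_add, exp_add]
  ring

lemma theta2_add_tau {τ : ℂ} (hτ : 0 < τ.im) (u : ℂ) :
    theta2 (u + τ) τ = -exp (-(Real.pi * I * τ)) * exp (-(2 * Real.pi * I * u)) * theta2 u τ := by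
  have h : -(2 * Real.pi * I * (u + τ / 2)) = -(Real.pi * I * τ) + -(2 * Real.pi * I * u) := by
    ring
  rw [theta2_eq hτ, theta2_eq hτ, add_right_comm, thetaProd_add_tau hτ, h, exp_add]
  ring

lemma theta_eq_zero_iff {τ : ℂ} (hτ : 0 < τ.im) {u : ℂ} :
    theta u τ = 0 ↔ u ∈ periodLattice τ := by
  rw [theta_eq hτ, ← thetaProd_eq_zero_iff hτ]
  simp [exp_ne_zero]

lemma theta2_eq_zero_iff {τ : ℂ} (hτ : 0 < τ.im) {u : ℂ} :
    theta2 u τ = 0 ↔ u + τ / 2 ∈ periodLattice τ := by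
  rw [theta2_eq hτ, thetaProd_eq_zero_iff hτ]

lemma differentiable_theta {τ : ℂ} (hτ : 0 < τ.im) : Differentiable ℂ fun u => theta u τ := by
  have := differentiable_thetaProd hτ
  simp only [theta_eq hτ]
  fun_prop

lemma differentiable_theta2 {τ : ℂ} (hτ : 0 < τ.im) : Differentiable ℂ fun u => theta2 u τ := by
  have := differentiable_thetaProd hτ
  simp only [theta2_eq hτ]
  fun_prop

lemma deriv_theta2_tau_half {τ : ℂ} (hτ : 0 < τ.im) :
    deriv (fun u => theta2 u τ) (τ / 2) = -deriv (thetaProd τ) 0 := by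
  have h := deriv_thetaProd_add_tau hτ 0
  simp only [theta2_eq hτ]
  rw [deriv_comp_add_const, add_halves]
  simpa [thetaProd_zero hτ] using h

lemma theta_div_theta2_add_one {τ : ℂ} (hτ : 0 < τ.im) (v u : ℂ) :
    theta (u + 1) τ / theta2 (v + (u + 1)) τ = -(theta u τ / theta2 (v + u) τ) := by
  rw [← add_assoc, theta_add_one hτ, theta2_add_one hτ, neg_div]

lemma theta_div_theta2_add_tau {τ : ℂ} (hτ : 0 < τ.im) (v u : ℂ) :
    theta (u + τ) τ / theta2 (v + (u + τ)) τ =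
      exp (2 * Real.pi * I * v) * (theta u τ / theta2 (v + u) τ) := by
  have h : -(2 * Real.pi * I * (v + u)) = -(2 * Real.pi * I * u) + -(2 * Real.pi * I * v) := by
    ring
  have h0 := exp_ne_zero (-(Real.pi * I * τ))
  have h1 := exp_ne_zero (-(2 * Real.pi * I * u))
  have h2 := exp_ne_zero (2 * Real.pi * I * v)
  rw [← add_assoc, theta_add_tau hτ, theta2_add_tau hτ, h, exp_add, exp_neg (2 * Real.pi * I * v)]
  field_simp

lemma theta_div_theta2_add_nat_add_nat_mul {τ : ℂ} (hτ : 0 < τ.im) (v u : ℂ) (a b : ℕ) :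
    theta (u + a + b * τ) τ / theta2 (v + (u + a + b * τ)) τ =
      (-1) ^ a * exp (2 * Real.pi * I * b * v) * (theta u τ / theta2 (v + u) τ) := by
  induction b with
  | zero =>
    simp only [Nat.cast_zero, zero_mul, mul_zero, add_zero, exp_zero, mul_one]
    induction a with
    | zero => simp
    | succ a ih =>
      rw [Nat.cast_succ, ← add_assoc, theta_div_theta2_add_one hτ, ih]
      ring
  | succ b ih =>
    have h : 2 * Real.pi * I * ((b + 1 : ℕ) : ℂ) * v =
        2 * Real.pi * I * v + 2 * Real.pi * I * b * v := by
      push_cast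
      ring
    rw [h, exp_add, Nat.cast_succ, add_mul, one_mul, ← add_assoc, theta_div_theta2_add_tau hτ, ih]
    ring

lemma int_eq_zero_of_add_mul_eq_zero {τ : ℂ} (hτ : 0 < τ.im) {x y : ℤ}
    (h : (x : ℂ) + y * τ = 0) : x = 0 ∧ y = 0 := by
  have him := congrArg Complex.im h
  simp [hτ.ne'] at him
  subst him
  simpa using h

lemma torsion_sub_notMem_periodLattice {τ : ℂ} (hτ : 0 < τ.im) (c : ℂ) {m a b a' b' : ℕ}
    (ha : a < m) (hb : b < m) (ha' : a' < m) (hb' : b' < m) (hne : (a, b) ≠ (a', b')) :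
    (c + a + b * τ) / m - (c + a' + b' * τ) / m ∉ periodLattice τ := by
  intro h
  obtain ⟨A, B, hAB⟩ := mem_periodLattice.1 h
  have hm : (m : ℂ) ≠ 0 := Nat.cast_ne_zero.2 (by omega)
  have h0 : (((m : ℤ) * A - (a - a') : ℤ) : ℂ) + ((m : ℤ) * B - (b - b') : ℤ) * τ = 0 := by
    push_cast
    field_simp at hAB
    linear_combination hAB
  obtain ⟨hA, hB⟩ := int_eq_zero_of_add_mul_eq_zero hτ h0
  have key : ∀ {x y : ℕ} {X : ℤ}, x < m → y < m → (m : ℤ) * X - (x - y) = 0 → x = y := by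
    intro x y X hx hy hX
    have hdvd : (m : ℤ) ∣ x - y := ⟨X, by linarith⟩
    have := Int.eq_zero_of_abs_lt_dvd hdvd (by rw [abs_lt]; constructor <;> omega)
    omega
  exact hne (Prod.ext (key ha ha' hA) (key hb hb' hB))

lemma exists_torsion_sub_mem_periodLattice {τ c p : ℂ} {m : ℕ} (hm : 1 ≤ m)
    (h : m * p - c ∈ periodLattice τ) :
    ∃ a < m, ∃ b < m, p - (c + (a : ℕ) + (b : ℕ) * τ) / m ∈ periodLattice τ := by
  obtain ⟨A, B, hAB⟩ := mem_periodLattice.1 h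
  have hm0 : (m : ℤ) ≠ 0 := by omega
  have hmC : (m : ℂ) ≠ 0 := Nat.cast_ne_zero.2 (by omega)
  have key : ∀ X : ℤ, ∃ x < m, ∃ Y : ℤ, (X : ℂ) = (x : ℕ) + m * Y := fun X => by
    have h0 := Int.emod_nonneg X hm0
    refine ⟨(X % m).toNat, ?_, X / m, ?_⟩
    · have := Int.emod_lt_of_pos X (by omega : (0 : ℤ) < m)
      omega
    · have h1 := Int.emod_add_mul_ediv X m
      have h2 := Int.toNat_of_nonneg h0
      have h3 : X = ((X % m).toNat : ℤ) + m * (X / m) := by rw [h2, h1]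
      exact_mod_cast congrArg (Int.cast : ℤ → ℂ) h3
  obtain ⟨a, ha, A', hA⟩ := key A
  obtain ⟨b, hb, B', hB⟩ := key B
  refine ⟨a, ha, b, hb, mem_periodLattice.2 ⟨A', B', ?_⟩⟩
  rw [hA, hB] at hAB
  field_simp
  linear_combination hAB

/-- Theorem 6.9 (NS elliptic genus / Landau-Ginzburg correspondence): for `N−m`
even and `(N−m)v ∈ ℤ`, the residue of
`θ(mz,τ)/θ₂(v+mz,τ)·(θ₂(v+z,τ)/θ(z,τ))^N` at the origin equals
`−(θ(−v+τ/2,τ)/θ₂'(τ/2,τ))·(1/m)·∑_{a,b=0}^{m−1}(−1)^a e^{2πibv}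
(θ₂(v+w_{a,b},τ)/θ(w_{a,b},τ))^N`, where `w_{a,b} = (−v+a+bτ+τ/2)/m`. -/
theorem NS_elliptic_genus_eq_LG_orbifold
    (τ : ℂ) (hτ : 0 < τ.im) (v : ℂ) (m N : ℕ) (hm : 1 ≤ m) (hN : 2 ≤ N)
    (heven : ∃ k : ℤ, (N : ℤ) - (m : ℤ) = 2 * k)
    (hint : ∃ k : ℤ, ((N : ℂ) - (m : ℂ)) * v = (k : ℂ))
    (hθ2v : theta2 v τ ≠ 0)
    (hθ2' : deriv (fun w => theta2 w τ) (τ / 2) ≠ 0)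
    (hw : ∀ a b : ℕ, a < m → b < m →
      theta ((-v + a + b * τ + τ / 2) / m) τ ≠ 0 ∧
        theta2 (v + (-v + a + b * τ + τ / 2) / m) τ ≠ 0) :
    ∀ᶠ ε in nhdsWithin (0 : ℝ) (Set.Ioi 0),
      (2 * (Real.pi : ℂ) * I)⁻¹ *
          (∮ z in C(0, ε),
            theta ((m : ℂ) * z) τ / theta2 (v + (m : ℂ) * z) τ *
              (theta2 (v + z) τ / theta z τ) ^ N) =
        -(theta (-v + τ / 2) τ / deriv (fun w => theta2 w τ) (τ / 2)) *
          ((1 / m) *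
            ∑ a ∈ Finset.range m, ∑ b ∈ Finset.range m,
              (-1 : ℂ) ^ a * exp (2 * (Real.pi : ℂ) * I * (b : ℂ) * v) *
                (theta2 (v + (-v + a + b * τ + τ / 2) / m) τ /
                  theta ((-v + a + b * τ + τ / 2) / m) τ) ^ N) := by
  have hmC : (m : ℂ) ≠ 0 := Nat.cast_ne_zero.2 (by omega)
  have hdθ := differentiable_theta hτ
  have hdθ2 := differentiable_theta2 hτ
  have haθ : ∀ u, AnalyticAt ℂ (fun u => theta u τ) u := hdθ.analyticAt
  have haθ2 : ∀ u, AnalyticAt ℂ (fun u => theta2 u τ) u := hdθ2.analyticAt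
  have hDθ0 : deriv (thetaProd τ) 0 ≠ 0 := by
    rw [deriv_theta2_tau_half hτ] at hθ2'
    exact neg_ne_zero.1 hθ2'
  have hwp : ∀ a b : ℕ,
      (-v + a + b * τ + τ / 2) / m = ((-v + τ / 2) + a + b * τ) / m := fun a b => by ring
  set F : ℂ → ℂ := fun z => theta ((m : ℂ) * z) τ / theta2 (v + (m : ℂ) * z) τ *
    (theta2 (v + z) τ / theta z τ) ^ N with hF
  have hFQ : ∀ z, F z = theta (m * z) τ / theta2 (v + m * z) τ *
      ((theta z τ / theta2 (v + z) τ)⁻¹) ^ N := fun z => by simp only [hF, inv_div]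
  have h1 : ∀ z, F (z + 1) = F z := fun z => by
    have hshift := theta_div_theta2_add_nat_add_nat_mul hτ v (m * z) m 0
    simp only [Nat.cast_zero, zero_mul, mul_zero, add_zero, exp_zero, mul_one] at hshift
    have hsign : (-1 : ℂ) ^ m * (-1) ^ N = 1 := by
      obtain ⟨k, hk⟩ := heven
      rw [← pow_add]
      exact Even.neg_one_pow ⟨(k + m).toNat, by omega⟩
    rw [hFQ, hFQ, theta_div_theta2_add_one hτ, mul_add, mul_one, hshift, inv_neg, neg_pow _ N]
    linear_combination (theta (m * z) τ / theta2 (v + m * z) τ *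
      ((theta z τ / theta2 (v + z) τ)⁻¹) ^ N) * hsign
  have h2 : ∀ z, F (z + τ) = F z := fun z => by
    have hshift := theta_div_theta2_add_nat_add_nat_mul hτ v (m * z) 0 m
    simp only [Nat.cast_zero, pow_zero, add_zero, one_mul] at hshift
    have hmult : exp (2 * Real.pi * I * m * v) * ((exp (2 * Real.pi * I * v))⁻¹) ^ N = 1 := by
      obtain ⟨k, hk⟩ := hint
      rw [← exp_neg, ← exp_nat_mul, ← exp_add, exp_eq_one_iff]
      refine ⟨-k, ?_⟩
      push_cast
      linear_combination (-2 * Real.pi * I) * hk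
    rw [hFQ, hFQ, theta_div_theta2_add_tau hτ, mul_add, hshift, mul_inv, mul_pow]
    linear_combination (theta (m * z) τ / theta2 (v + m * z) τ *
      ((theta z τ / theta2 (v + z) τ)⁻¹) ^ N) * hmult
  set w : ℕ × ℕ → ℂ := fun j => (-v + j.1 + j.2 * τ + τ / 2) / m with hwdef
  have hθ2half : theta2 (τ / 2) τ = 0 := by
    rw [theta2_eq_zero_iff hτ, add_halves]
    exact mem_periodLattice.2 ⟨0, 1, by simp⟩
  have key := eventually_circleIntegral_eq_neg_sum_residues hτ hDθ0
    (s := Finset.range m ×ˢ Finset.range m) (w := w)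
    (r := fun j => (-1) ^ j.1 * exp (2 * Real.pi * I * j.2 * v) * theta (-v + τ / 2) τ *
      (theta2 (v + w j) τ / theta (w j) τ) ^ N / (m * deriv (fun w => theta2 w τ) (τ / 2)))
    (F := F) h1 h2 ?_ ?_ ?_ ?_ ?_
  · filter_upwards [key] with ε hε
    rw [hε, Finset.sum_product, ← Finset.sum_neg_distrib, Finset.mul_sum, Finset.mul_sum]
    refine Finset.sum_congr rfl fun a _ => ?_
    rw [← Finset.sum_neg_distrib, Finset.mul_sum, Finset.mul_sum]
    refine Finset.sum_congr rfl fun b _ => ?_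
    simp only [hwdef]
    field_simp
  · rintro ⟨a, b⟩ hj
    simp only [Finset.mem_product, Finset.mem_range] at hj
    exact fun h => (hw a b hj.1 hj.2).1 ((theta_eq_zero_iff hτ).2 h)
  · rintro ⟨a, b⟩ hj ⟨a', b'⟩ hj' hne
    simp only [Finset.mem_product, Finset.mem_range] at hj hj'
    simp only [hwdef, hwp]
    exact torsion_sub_notMem_periodLattice hτ _ hj.1 hj.2 hj'.1 hj'.2 hne
  · rintro ⟨a, b⟩ hj
    simp only [Finset.mem_product, Finset.mem_range] at hj
    have hθw : theta (w (a, b)) τ ≠ 0 := (hw a b hj.1 hj.2).1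
    have hg : HasDerivAt (fun z => theta2 (τ / 2 + m * (z - w (a, b))) τ)
        (deriv (fun w => theta2 w τ) (τ / 2) * m) (w (a, b)) := by
      have hin : HasDerivAt (fun z => τ / 2 + m * (z - w (a, b))) (m : ℂ) (w (a, b)) := by
        simpa using (((hasDerivAt_id (w (a, b))).sub_const (w (a, b))).const_mul
          (m : ℂ)).const_add (τ / 2)
      exact HasDerivAt.comp_of_eq _ (hdθ2 (τ / 2)).hasDerivAt hin (by simp)
    have hdiv := hasAnalyticExtensionAt_div_sub (p := w (a, b))
      (f := fun z => (-1) ^ a * exp (2 * Real.pi * I * b * v) *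
        theta (-v + τ / 2 + m * (z - w (a, b))) τ * (theta2 (v + z) τ / theta z τ) ^ N)
      (g := fun z => theta2 (τ / 2 + m * (z - w (a, b))) τ)
      ((analyticAt_const.mul ((haθ _).comp_of_eq
          (f := fun z => -v + τ / 2 + m * (z - w (a, b))) (by fun_prop) rfl)).mul
        ((((haθ2 _).comp_of_eq (f := fun z => v + z) (by fun_prop) rfl).div (haθ _) hθw).pow N))
      ((haθ2 _).comp_of_eq (f := fun z => τ / 2 + m * (z - w (a, b))) (by fun_prop) rfl)
      (by simpa using hθ2half) (by rw [hg.deriv]; exact mul_ne_zero hθ2' hmC)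
    rw [hg.deriv] at hdiv
    refine hdiv.congr (.of_forall fun z => ?_)
    have hmz : (m : ℂ) * z = -v + τ / 2 + m * (z - w (a, b)) + a + b * τ := by
      simp only [hwdef]
      field_simp
      ring
    have hshift := theta_div_theta2_add_nat_add_nat_mul hτ v
      (-v + τ / 2 + m * (z - w (a, b))) a b
    rw [← hmz, show v + (-v + τ / 2 + m * (z - w (a, b))) = τ / 2 + m * (z - w (a, b)) by ring]
      at hshift
    simp only [hF, hshift, sub_self, mul_zero, add_zero]
    ring
  · have hm1 : MeromorphicAt (fun z => theta (m * z) τ) 0 :=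
      ((haθ _).comp_of_eq (f := fun z : ℂ => (m : ℂ) * z) (by fun_prop) rfl).meromorphicAt
    have hm2 : MeromorphicAt (fun z => theta2 (v + m * z) τ) 0 :=
      ((haθ2 _).comp_of_eq (f := fun z => v + m * z) (by fun_prop) rfl).meromorphicAt
    have hm3 : MeromorphicAt (fun z => theta2 (v + z) τ) 0 :=
      ((haθ2 _).comp_of_eq (f := fun z => v + z) (by fun_prop) rfl).meromorphicAt
    exact (hm1.div hm2).mul ((hm3.div (haθ 0).meromorphicAt).pow N)
  · intro p hp hpw
    have hθp : theta p τ ≠ 0 := mt (theta_eq_zero_iff hτ).1 hp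
    have hθ2p : theta2 (v + m * p) τ ≠ 0 := fun h => by
      obtain ⟨A, B, hAB⟩ := mem_periodLattice.1 ((theta2_eq_zero_iff hτ).1 h)
      obtain ⟨a, ha, b, hb, hab⟩ := exists_torsion_sub_mem_periodLattice (τ := τ)
        (c := -v + τ / 2) (p := p)
        hm (mem_periodLattice.2 ⟨A, B - 1, by push_cast; linear_combination hAB⟩)
      refine hpw (a, b) (by simp [ha, hb]) ?_
      simpa only [hwdef, hwp] using hab
    exact (((haθ _).comp_of_eq (f := fun z : ℂ => (m : ℂ) * z) (by fun_prop) rfl).div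
        ((haθ2 _).comp_of_eq (f := fun z => v + m * z) (by fun_prop) rfl) hθ2p).mul
      ((((haθ2 _).comp_of_eq (f := fun z => v + z) (by fun_prop) rfl).div (haθ p) hθp).pow N)
end
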